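/- arXiv:2204.05026 — 6 statements merged into one kernel-verified Lean document; each statement's English description precedes it below -/
import Mathlib

section
/- Let n be a positive integer divisible by 4, let Γ = IOCG_n(D,σ) be an integral oriented circulant graph with Hermitian eigenvalues μ_0,…,μ_{n−1} (indices read modulo n), and let a, b ∈ Z_n be distinct vertices. Then Γ has perfect state transfer between a and b if and only if there exist coprime integers p and q (q ≠ 0) such that (p/q)(μ_{j+1} − μ_j) + (a−b)/n ∈ ℤ for all j = 0, 1, …, n−1, where a−b is taken as an integer representative. -/
open Complex Finset

noncomputable section

/-- `G_n^r(d) = { dk : k ≡ r (mod 4), gcd(dk, n) = d } ⊆ {1, …, n−1}`. -/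
def Gsetr (n r d : ℕ) : Finset ℕ :=
  (Finset.range n).filter (fun a => d ∣ a ∧ (a / d) % 4 = r ∧ Nat.gcd a n = d)

/-- The symbol `C = ⋃_{d ∈ D} S_n(d)` of the integral oriented circulant graph
`IOCG_n(D, σ)`, where `S_n(d) = G_n^1(d)` if `σ d = 1` and `S_n(d) = G_n^3(d)` otherwise. -/
def symbol (n : ℕ) (D : Finset ℕ) (σ : ℕ → ℤ) : Finset ℕ :=
  D.biUnion (fun d => Gsetr n (if σ d = 1 then 1 else 3) d)

/-- The Hermitian adjacency matrix of the oriented circulant graph with symbol `C`. -/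
def hermMatrix (n : ℕ) [NeZero n] (C : Finset ℕ) : Matrix (ZMod n) (ZMod n) ℂ :=
  Matrix.of fun u v =>
    if (v - u).val ∈ C then Complex.I
    else if (u - v).val ∈ C then -Complex.I else 0

/-- The transition matrix `U(t) = exp(i t H)`. -/
def transitionMatrix (n : ℕ) [NeZero n] (C : Finset ℕ) (t : ℝ) :
    Matrix (ZMod n) (ZMod n) ℂ :=
  NormedSpace.exp ((Complex.I * (t : ℂ)) • hermMatrix n C)

/-- Perfect state transfer from `u` to `v`. -/
def hasPST (n : ℕ) [NeZero n] (C : Finset ℕ) (u v : ZMod n) : Prop :=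
  ∃ (t : ℝ) (γ : ℂ), ‖γ‖ = 1 ∧
    (transitionMatrix n C t).mulVec (Pi.single u 1) = γ • (Pi.single v 1 : ZMod n → ℂ)

/-- Multiple state transfer on a vertex set `S`: PST between every pair of
distinct vertices of `S`. -/
def hasMST (n : ℕ) [NeZero n] (C : Finset ℕ) (S : Set (ZMod n)) : Prop :=
  ∀ u ∈ S, ∀ v ∈ S, u ≠ v → hasPST n C u v

/-- The Hermitian eigenvalues `μ_j = i ∑_{k ∈ C} (ω^{jk} − ω^{−jk})`, `ω = exp(2πi/n)`. -/
def eigval (n : ℕ) (C : Finset ℕ) (j : ℕ) : ℂ :=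
  Complex.I * ∑ k ∈ C, (Complex.exp (2 * Real.pi * Complex.I * j * k / n) -
    Complex.exp (-(2 * Real.pi * Complex.I * j * k / n)))

/-- Ramanujan's sum `c_n(q) = ∑_{1 ≤ a ≤ n, gcd(a,n)=1} exp(2πi a q / n)`. -/
def ramanujanSum (n q : ℕ) : ℂ :=
  ∑ a ∈ (Finset.Icc 1 n).filter (fun a => Nat.gcd a n = 1),
    Complex.exp (2 * Real.pi * Complex.I * a * q / n)

/-- Ramanujan's sine sum `s_n(q) = i ∑_{a ∈ G_n^1(1)} (ω^{aq} − ω^{−aq})`. -/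
def sineSum (n q : ℕ) : ℂ :=
  Complex.I * ∑ a ∈ Gsetr n 1 1, (Complex.exp (2 * Real.pi * Complex.I * a * q / n) -
    Complex.exp (-(2 * Real.pi * Complex.I * a * q / n)))

open ZMod (stdAddChar stdAddChar_apply stdAddChar_coe dft dft_apply)

/-- An element of the symbol is never the negative of another one. -/
lemma neg_val_notMem_symbol {n : ℕ} [NeZero n] (hn4 : 4 ∣ n) {D : Finset ℕ}
    (hD : ∀ d ∈ D, d ∣ n / 4) (σ : ℕ → ℤ) {k : ZMod n} (hk : k.val ∈ symbol n D σ) :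
    (-k).val ∉ symbol n D σ := by
  intro hk'
  simp only [symbol, Gsetr, mem_biUnion, mem_filter] at hk hk'
  obtain ⟨d, hd, -, hdk, hmod, hgcd⟩ := hk
  obtain ⟨e, -, -, hek, hmod', hgcd'⟩ := hk'
  have hk0 : k ≠ 0 := by
    rintro rfl
    split_ifs at hmod <;> simp at hmod
  have := NeZero.mk hk0
  rw [ZMod.val_neg_of_ne_zero] at hek hmod' hgcd'
  have hlt := k.val_lt.le
  have hde : d = e := by
    rw [← hgcd, ← hgcd', Nat.gcd_comm, Nat.gcd_comm (n - k.val), Nat.gcd_self_sub_right hlt]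
  subst hde
  obtain ⟨c, hc⟩ := hD d hd
  obtain ⟨x, hx⟩ := hdk
  have hn : n = d * (4 * c) := by
    rw [mul_left_comm, ← hc, Nat.mul_div_cancel' hn4]
  have hd0 : 0 < d := Nat.pos_of_ne_zero (by rintro rfl; exact NeZero.ne n (by simpa using hn))
  have hsub : n - k.val = d * (4 * c - x) := by rw [Nat.mul_sub, ← hn, ← hx]
  have hxc : x ≤ 4 * c := Nat.le_of_mul_le_mul_left (by rwa [← hn, ← hx]) hd0
  rw [hx, Nat.mul_div_cancel_left _ hd0] at hmod
  rw [hsub, Nat.mul_div_cancel_left _ hd0] at hmod'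
  split_ifs at hmod hmod' <;> omega

lemma lt_of_mem_symbol {n : ℕ} {D : Finset ℕ} {σ : ℕ → ℤ} {k : ℕ}
    (hk : k ∈ symbol n D σ) : k < n := by
  simp only [symbol, Gsetr, mem_biUnion, mem_filter, Finset.mem_range] at hk
  obtain ⟨d, -, hk, -⟩ := hk
  exact hk

/-- The eigenvalue of the Hermitian adjacency matrix at the character indexed by `k`. -/
def charEigval (n : ℕ) [NeZero n] (C : Finset ℕ) (k : ZMod n) : ℂ :=
  ∑ m : ZMod n, hermMatrix n C 0 m * stdAddChar (m * k)

/-- The matrix of the discrete Fourier transform. -/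
def dftMatrix (n : ℕ) [NeZero n] : Matrix (ZMod n) (ZMod n) ℂ :=
  Matrix.of fun k j => stdAddChar (-(j * k))

lemma dftMatrix_mulVec {n : ℕ} [NeZero n] (x : ZMod n → ℂ) :
    (dftMatrix n).mulVec x = dft x := by
  ext k
  simp [dftMatrix, Matrix.mulVec, dotProduct, dft_apply]

lemma dftMatrix_mul_hermMatrix {n : ℕ} [NeZero n] (C : Finset ℕ) :
    dftMatrix n * hermMatrix n C = Matrix.diagonal (charEigval n C) * dftMatrix n := by
  ext k v
  rw [Matrix.diagonal_mul, Matrix.mul_apply, charEigval, Finset.sum_mul]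
  refine Fintype.sum_equiv (Equiv.subLeft v) _ _ fun u => ?_
  have hH : hermMatrix n C 0 (v - u) = hermMatrix n C u v := by simp [hermMatrix]
  have hchar : (stdAddChar (-(u * k)) : ℂ) =
      stdAddChar ((v - u) * k) * stdAddChar (-(v * k)) := by
    rw [← AddChar.map_add_eq_mul]
    congr 1
    ring
  simp only [dftMatrix, Matrix.of_apply, Equiv.subLeft_apply, hH, hchar]
  ring

lemma dftMatrix_mul_transitionMatrix {n : ℕ} [NeZero n] (C : Finset ℕ) (t : ℝ) :
    dftMatrix n * transitionMatrix n C t =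
      Matrix.diagonal (fun k => exp (I * t * charEigval n C k)) * dftMatrix n := by
  have h : SemiconjBy (dftMatrix n) ((I * (t : ℂ)) • hermMatrix n C)
      (Matrix.diagonal fun k => I * t * charEigval n C k) := by
    rw [SemiconjBy, Matrix.mul_smul, dftMatrix_mul_hermMatrix, ← Matrix.smul_mul,
      ← Matrix.diagonal_smul]
    rfl
  have hexp : SemiconjBy (dftMatrix n) (transitionMatrix n C t)
      (NormedSpace.exp (Matrix.diagonal fun k => I * t * charEigval n C k)) := by
    open scoped Matrix.Norms.Operator in exact h.exp_right
  rw [hexp.eq, Matrix.exp_diagonal]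
  congr 2
  ext k
  rw [Pi.coe_exp, Complex.exp_eq_exp_ℂ]

lemma dft_single {n : ℕ} [NeZero n] (a k : ZMod n) :
    dft (Pi.single a 1 : ZMod n → ℂ) k = stdAddChar (-(a * k)) := by
  rw [dft_apply, Finset.sum_eq_single a] <;> simp +contextual

/-- Perfect state transfer, read off on the Fourier side. -/
lemma transitionMatrix_mulVec_single_eq_iff {n : ℕ} [NeZero n] (C : Finset ℕ) (t : ℝ) (γ : ℂ)
    (a b : ZMod n) :
    (transitionMatrix n C t).mulVec (Pi.single a 1) = γ • (Pi.single b 1 : ZMod n → ℂ) ↔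
      ∀ k, exp (I * t * charEigval n C k) * stdAddChar ((b - a) * k) = γ := by
  rw [← (dft (N := n) (E := ℂ)).injective.eq_iff, map_smul, ← dftMatrix_mulVec,
    Matrix.mulVec_mulVec, dftMatrix_mul_transitionMatrix, ← Matrix.mulVec_mulVec,
    dftMatrix_mulVec, funext_iff]
  refine forall_congr' fun k => ?_
  rw [Matrix.mulVec_diagonal, dft_single, Pi.smul_apply, dft_single, smul_eq_mul]
  have hchar : (stdAddChar (-(a * k)) : ℂ) =
      stdAddChar ((b - a) * k) * stdAddChar (-(b * k)) := by
    rw [← AddChar.map_add_eq_mul]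
    congr 1
    ring
  have hne : (stdAddChar (-(b * k)) : ℂ) ≠ 0 := by
    rw [stdAddChar_apply]
    exact Circle.coe_ne_zero _
  rw [hchar, ← mul_assoc, mul_left_inj' hne]

lemma charEigval_natCast {n : ℕ} [NeZero n] (hn4 : 4 ∣ n) {D : Finset ℕ}
    (hD : ∀ d ∈ D, d ∣ n / 4) (σ : ℕ → ℤ) (j : ℕ) :
    charEigval n (symbol n D σ) j = eigval n (symbol n D σ) j := by
  set C := symbol n D σ
  have hH (m : ZMod n) : hermMatrix n C 0 m =
      (if m.val ∈ C then I else 0) - (if (-m).val ∈ C then I else 0) := by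
    simp only [hermMatrix, Matrix.of_apply, sub_zero, zero_sub]
    by_cases hm : m.val ∈ C
    · have hm' : (-m).val ∉ C := neg_val_notMem_symbol hn4 hD σ hm
      simp [hm, hm']
    · simp only [hm, if_false]
      split_ifs <;> simp
  have hneg : ∑ m : ZMod n, (if (-m).val ∈ C then I else 0) * (stdAddChar (m * (j : ZMod n)) : ℂ) =
      ∑ m : ZMod n, (if m.val ∈ C then I else 0) * (stdAddChar (-(m * (j : ZMod n))) : ℂ) :=
    Fintype.sum_equiv (Equiv.neg _) _ _ fun m => by simp
  have hexp (k : ℕ) : (stdAddChar ((k : ZMod n) * (j : ZMod n)) : ℂ) =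
      exp (2 * Real.pi * I * j * k / n) := by
    have := stdAddChar_coe (N := n) ((k : ℤ) * j)
    push_cast at this
    rw [this]
    congr 1
    ring
  have hexp_neg (k : ℕ) : (stdAddChar (-((k : ZMod n) * (j : ZMod n))) : ℂ) =
      exp (-(2 * Real.pi * I * j * k / n)) := by
    rw [AddChar.map_neg_eq_inv, hexp, Complex.exp_neg]
  simp only [charEigval, hH, sub_mul, Finset.sum_sub_distrib, hneg]
  rw [← Finset.sum_sub_distrib, eigval, Finset.mul_sum]
  simp_rw [← mul_sub, ite_mul, zero_mul]
  rw [← Finset.sum_filter]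
  refine Finset.sum_bij' (fun m _ => m.val) (fun k _ => (k : ZMod n)) ?_ ?_ ?_ ?_ ?_
  · intro m hm
    exact (Finset.mem_filter.mp hm).2
  · intro k hk
    simpa [ZMod.val_natCast_of_lt (lt_of_mem_symbol hk)] using hk
  · intro m _
    simp
  · intro k hk
    exact ZMod.val_natCast_of_lt (lt_of_mem_symbol hk)
  · intro m _
    rw [← hexp, ← hexp_neg, ZMod.natCast_zmod_val]

/-- Perfect state transfer in terms of integral eigenvalues. -/
lemma hasPST_iff_exists_real {n : ℕ} [NeZero n] {C : Finset ℕ} {μ : ℕ → ℤ}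
    (hμ : ∀ j < n, charEigval n C j = μ j) (a b : ZMod n) :
    hasPST n C a b ↔ ∃ s : ℝ, ∀ j < n, ∃ z : ℤ,
      s * (μ ((j + 1) % n) - μ j) + ((a - b).val : ℝ) / n = z := by
  have hn : 0 < n := NeZero.pos n
  let g (t : ℝ) (j : ℕ) : ℂ := exp (I * t * μ j) * stdAddChar ((b - a) * (j : ZMod n))
  have hchar : (stdAddChar (b - a) : ℂ) = exp (-(2 * Real.pi * I * (a - b).val / n)) := by
    have := stdAddChar_coe (N := n) ((a - b).val : ℤ)
    push_cast [ZMod.natCast_zmod_val] at this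
    rw [← neg_sub a b, AddChar.map_neg_eq_inv, this, Complex.exp_neg]
  have hstep (s : ℝ) (j : ℕ) : g (-(2 * Real.pi * s)) ((j + 1) % n) = g (-(2 * Real.pi * s)) j ↔
      ∃ z : ℤ, s * (μ ((j + 1) % n) - μ j) + ((a - b).val : ℝ) / n = z := by
    have hne : (stdAddChar ((b - a) * (j : ZMod n)) : ℂ) ≠ 0 := by
      rw [stdAddChar_apply]
      exact Circle.coe_ne_zero _
    simp only [g]
    rw [ZMod.natCast_mod, Nat.cast_succ, mul_add, mul_one, add_comm ((b - a) * (j : ZMod n)),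
      AddChar.map_add_eq_mul, ← mul_assoc, mul_left_inj' hne, hchar, ← Complex.exp_add,
      eq_comm, Complex.exp_eq_exp_iff_exists_int]
    refine exists_congr fun z => ?_
    rw [← Complex.ofReal_inj]
    push_cast
    have h2 : (2 * Real.pi * I : ℂ) ≠ 0 := Complex.two_pi_I_ne_zero
    rw [← mul_right_inj' h2 (b := _ + _)]
    constructor <;> intro h <;> linear_combination h
  have hpst (t : ℝ) (γ : ℂ) :
      (transitionMatrix n C t).mulVec (Pi.single a 1) = γ • (Pi.single b 1 : ZMod n → ℂ) ↔
        ∀ j < n, g t j = γ := by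
    rw [transitionMatrix_mulVec_single_eq_iff]
    constructor
    · intro h j hj
      rw [← h j, hμ j hj]
    · intro h k
      simp only [← h k.val k.val_lt, g, ← hμ _ k.val_lt, ZMod.natCast_zmod_val]
  constructor
  · rintro ⟨t, γ, -, h⟩
    rw [hpst] at h
    refine ⟨-(t / (2 * Real.pi)), fun j hj => (hstep _ j).mp ?_⟩
    have ht : -(2 * Real.pi * -(t / (2 * Real.pi))) = t := by
      field_simp
    rw [ht, h j hj, h _ (Nat.mod_lt _ hn)]
  · rintro ⟨s, hs⟩
    refine ⟨-(2 * Real.pi * s), g (-(2 * Real.pi * s)) 0, ?_, (hpst _ _).mpr fun j hj => ?_⟩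
    · have harg : I * ((-(2 * Real.pi * s) : ℝ) : ℂ) * μ 0 =
          ((-(2 * Real.pi * s) * μ 0 : ℝ) : ℂ) * I := by
        push_cast
        ring
      simp only [g, harg, norm_mul, Complex.norm_exp_ofReal_mul_I]
      simp
    · induction j with
      | zero => rfl
      | succ j ih =>
        have := (hstep s j).mpr (hs j (Nat.lt_of_succ_lt hj))
        rw [Nat.mod_eq_of_lt hj] at this
        rw [this, ih (Nat.lt_of_succ_lt hj)]

theorem pst_iff_rational_condition (n : ℕ) [NeZero n] (hn4 : 4 ∣ n)
    (D : Finset ℕ) (hD : ∀ d ∈ D, d ∣ n / 4)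
    (σ : ℕ → ℤ) (hσ : ∀ d ∈ D, σ d = 1 ∨ σ d = -1)
    (μ : ℕ → ℤ) (hμ : ∀ j < n, (μ j : ℂ) = eigval n (symbol n D σ) j)
    (a b : ZMod n) (hab : a ≠ b) :
    hasPST n (symbol n D σ) a b ↔
      ∃ p q : ℤ, IsCoprime p q ∧ q ≠ 0 ∧ ∀ j < n, ∃ z : ℤ,
        (p : ℚ) / q * (μ ((j + 1) % n) - μ j) + ((a - b).val : ℚ) / n = z := by
  have hcirc : ∀ j < n, charEigval n (symbol n D σ) j = μ j := fun j hj => by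
    rw [charEigval_natCast hn4 hD, hμ j hj]
  rw [hasPST_iff_exists_real hcirc]
  constructor
  · rintro ⟨s, hs⟩
    obtain ⟨j, hj, hΔ⟩ : ∃ j < n, μ ((j + 1) % n) - μ j ≠ 0 := by
      by_contra! hall
      obtain ⟨z, hz⟩ := hs 0 (NeZero.pos n)
      have h0 : (μ ((0 + 1) % n) - μ 0 : ℝ) = 0 := by exact_mod_cast hall 0 (NeZero.pos n)
      have hn0 : (n : ℝ) ≠ 0 := NeZero.ne _
      rw [h0, mul_zero, zero_add, div_eq_iff hn0] at hz
      have hdvd : (n : ℤ) ∣ ((a - b).val : ℤ) := ⟨z, by rw [mul_comm]; exact_mod_cast hz⟩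
      rw [← ZMod.intCast_zmod_eq_zero_iff_dvd] at hdvd
      push_cast [ZMod.natCast_zmod_val] at hdvd
      exact hab (sub_eq_zero.mp hdvd)
    obtain ⟨z, hz⟩ := hs j hj
    obtain ⟨r, rfl⟩ : ∃ r : ℚ, (r : ℝ) = s := by
      refine ⟨(z - ((a - b).val : ℚ) / n) / ((μ ((j + 1) % n) - μ j : ℤ) : ℚ), ?_⟩
      have hΔ' : ((μ ((j + 1) % n) - μ j : ℤ) : ℝ) ≠ 0 := by exact_mod_cast hΔ
      push_cast at hΔ' ⊢
      rw [div_eq_iff hΔ', ← hz]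
      ring
    refine ⟨r.num, r.den, Rat.isCoprime_num_den r, by exact_mod_cast r.den_ne_zero,
      fun i hi => ?_⟩
    obtain ⟨w, hw⟩ := hs i hi
    refine ⟨w, ?_⟩
    rw [Int.cast_natCast, Rat.num_div_den, ← Rat.cast_inj (α := ℝ)]
    push_cast
    exact hw
  · rintro ⟨p, q, -, -, h⟩
    refine ⟨((p / q : ℚ) : ℝ), fun j hj => ?_⟩
    obtain ⟨z, hz⟩ := h j hj
    rw [← Rat.cast_inj (α := ℝ)] at hz
    push_cast at hz ⊢
    exact ⟨z, hz⟩

end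
end

section
/- Let D be a nonempty finite set of odd positive integers. Then the integers Σ_{d∈D} c_d(q), as q ranges over all odd positive integers, all have the same parity if and only if D = {1}. -/
open Complex Finset

noncomputable section

lemma sum_odd_pow_eq_ite {N : ℕ} (hN : Odd N) {x : ℂ} (hx : x ^ N = 1) :
    ∑ k ∈ Finset.range N, x ^ (2 * k + 1) = if x = 1 then (N : ℂ) else 0 := by
  split_ifs with h1
  · simp [h1]
  have hsq : x ^ 2 ≠ 1 := by
    intro h
    apply h1
    obtain ⟨m, rfl⟩ := hN
    rwa [pow_succ, pow_mul, h, one_pow, one_mul] at hx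
  have hgeom := mul_neg_geom_sum (x ^ 2) N
  rw [← pow_mul, mul_comm 2 N, pow_mul, hx, one_pow, sub_self] at hgeom
  have hsum := (mul_eq_zero.mp hgeom).resolve_left (sub_ne_zero.mpr (Ne.symm hsq))
  simp_rw [pow_succ, pow_mul, ← Finset.sum_mul]
  rw [hsum, zero_mul]

lemma isPrimitiveRoot_exp_mul_div {d a : ℕ} (hd : 0 < d) (had : Nat.gcd a d = 1) :
    IsPrimitiveRoot (Complex.exp (2 * Real.pi * Complex.I * (a / d))) d :=
  Complex.isPrimitiveRoot_exp_of_coprime a d hd.ne' had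

lemma ramanujanSum_eq_sum_pow (n q : ℕ) :
    ramanujanSum n q = ∑ a ∈ (Finset.Icc 1 n).filter (fun a => Nat.gcd a n = 1),
      Complex.exp (2 * Real.pi * Complex.I * (a / n)) ^ q := by
  refine Finset.sum_congr rfl fun a _ => ?_
  rw [← Complex.exp_nat_mul]
  congr 1
  ring

lemma exp_mul_div_eq_iff {d e a : ℕ} (hd : 0 < d) (he : 1 < e)
    (ha : a ≤ d) (had : Nat.gcd a d = 1) :
    Complex.exp (2 * Real.pi * Complex.I * (a / d)) =
      Complex.exp (2 * Real.pi * Complex.I * ((1 : ℕ) / e)) ↔ d = e ∧ a = 1 := by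
  refine ⟨fun h => ?_, by rintro ⟨rfl, rfl⟩; rfl⟩
  have hz := isPrimitiveRoot_exp_mul_div hd had
  have hw := isPrimitiveRoot_exp_mul_div (zero_lt_one.trans he) (Nat.gcd_one_left e)
  have hde : d = e := hz.unique (h ▸ hw)
  subst hde
  refine ⟨rfl, ?_⟩
  have hlt : a < d := by
    refine lt_of_le_of_ne ha ?_
    rintro rfl
    rw [Nat.gcd_self] at had
    omega
  have hexp := Complex.isPrimitiveRoot_exp d hd.ne'
  refine hexp.pow_inj hlt he ?_
  rw [← Complex.exp_nat_mul, ← Complex.exp_nat_mul]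
  convert h using 2 <;> ring

/-- Orthogonality of Ramanujan sums with an additive character of exact order `e`, summed over
the odd residues. -/
lemma sum_ramanujanSum_mul_exp {N d e : ℕ} (hN : Odd N) (hd : 0 < d) (hdN : d ∣ N) (he : 1 < e)
    (heN : e ∣ N) :
    ∑ k ∈ Finset.range N, ramanujanSum d (2 * k + 1) *
      (Complex.exp (2 * Real.pi * Complex.I * ((1 : ℕ) / e)))⁻¹ ^ (2 * k + 1) =
      if d = e then (N : ℂ) else 0 := by
  set w := Complex.exp (2 * Real.pi * Complex.I * ((1 : ℕ) / e))
  have hw0 : w ≠ 0 := Complex.exp_ne_zero _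
  have hwN : w ^ N = 1 :=
    (isPrimitiveRoot_exp_mul_div (zero_lt_one.trans he) (Nat.gcd_one_left e)).pow_eq_one_iff_dvd N
      |>.mpr heN
  have hterm : ∀ a ∈ (Finset.Icc 1 d).filter (fun a => Nat.gcd a d = 1),
      ∑ k ∈ Finset.range N, (Complex.exp (2 * Real.pi * Complex.I * (a / d)) * w⁻¹) ^ (2 * k + 1) =
        if d = e ∧ a = 1 then (N : ℂ) else 0 := by
    intro a ha
    simp only [Finset.mem_filter, Finset.mem_Icc] at ha
    have hzN := (isPrimitiveRoot_exp_mul_div hd ha.2).pow_eq_one_iff_dvd N |>.mpr hdN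
    rw [sum_odd_pow_eq_ite hN (by rw [mul_pow, inv_pow, hzN, hwN, inv_one, mul_one])]
    simp only [mul_inv_eq_one₀ hw0, w, exp_mul_div_eq_iff hd he ha.1.2 ha.2]
  simp_rw [ramanujanSum_eq_sum_pow, Finset.sum_mul, ← mul_pow]
  rw [Finset.sum_comm, Finset.sum_congr rfl hterm]
  by_cases hde : d = e
  · subst hde
    simp [hd.ne', Nat.one_le_iff_ne_zero]
  · simp [hde]

lemma ramanujanSum_one_left (q : ℕ) : ramanujanSum 1 q = 1 := by
  rw [ramanujanSum_eq_sum_pow]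
  simp

lemma not_isIntegral_two_mul_eq_odd {N : ℕ} (hN : Odd N) {z : ℂ} (hz : IsIntegral ℤ z) :
    2 * z ≠ N := by
  intro h
  have hzq : z = algebraMap ℚ ℂ (N / 2) := by
    simp only [map_div₀, map_natCast, map_ofNat]
    rw [← h]
    ring
  rw [hzq, isIntegral_algebraMap_iff (algebraMap ℚ ℂ).injective] at hz
  obtain ⟨m, hm⟩ := IsIntegrallyClosed.isIntegral_iff.mp hz
  have hmN : 2 * m = (N : ℤ) := by
    have : (2 * m : ℚ) = N := by
      rw [eq_intCast] at hm
      rw [hm]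
      ring
    exact_mod_cast this
  obtain ⟨j, rfl⟩ := hN
  push_cast at hmN
  omega

theorem ramanujan_parity_iff (D : Finset ℕ) (hne : D.Nonempty)
    (hodd : ∀ d ∈ D, Odd d) (hpos : ∀ d ∈ D, 0 < d)
    (c : ℕ → ℕ → ℤ) (hc : ∀ d ∈ D, ∀ q, 0 < q → (c d q : ℂ) = ramanujanSum d q) :
    (∀ q₁ q₂ : ℕ, 0 < q₁ → 0 < q₂ → Odd q₁ → Odd q₂ →
      (∑ d ∈ D, c d q₁) % 2 = (∑ d ∈ D, c d q₂) % 2) ↔ D = {1} := by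
  constructor
  · intro hpar
    by_contra hD
    obtain ⟨e, heD, he1⟩ : ∃ e ∈ D, e ≠ 1 := by
      by_contra! hall
      exact hD (Finset.eq_singleton_iff_nonempty_unique_mem.mpr ⟨hne, hall⟩)
    have he : 1 < e := lt_of_le_of_ne (hpos e heD) (Ne.symm he1)
    set N := ∏ d ∈ D, d
    have hN : Odd N := Finset.prod_induction _ Odd (fun _ _ => Odd.mul) odd_one hodd
    have hdvd : ∀ d ∈ D, d ∣ N := fun d hd => Finset.dvd_prod_of_mem _ hd
    set w := Complex.exp (2 * Real.pi * Complex.I * ((1 : ℕ) / e))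
    have hprim : IsPrimitiveRoot w e :=
      isPrimitiveRoot_exp_mul_div (zero_lt_one.trans he) (Nat.gcd_one_left e)
    have hwN : w⁻¹ ^ N = 1 := (hprim.inv.pow_eq_one_iff_dvd N).mpr (hdvd e heD)
    have hw_int : IsIntegral ℤ w⁻¹ := hprim.inv.isIntegral (zero_lt_one.trans he)
    have hdiff : ∀ k : ℕ, ∃ g : ℤ, ∑ d ∈ D, c d (2 * k + 1) = ∑ d ∈ D, c d 1 + 2 * g := by
      intro k
      have h := hpar (2 * k + 1) 1 (by omega) one_pos (odd_two_mul_add_one k) odd_one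
      exact ⟨(∑ d ∈ D, c d (2 * k + 1) - ∑ d ∈ D, c d 1) / 2, by omega⟩
    choose g hg using hdiff
    have hfourier : ∑ k ∈ Finset.range N,
        ((∑ d ∈ D, c d (2 * k + 1) : ℤ) : ℂ) * w⁻¹ ^ (2 * k + 1) = N := by
      have hcast : ∀ k : ℕ, ((∑ d ∈ D, c d (2 * k + 1) : ℤ) : ℂ) =
          ∑ d ∈ D, ramanujanSum d (2 * k + 1) := by
        intro k
        push_cast
        exact Finset.sum_congr rfl fun d hd => hc d hd _ (by omega)
      simp_rw [hcast, Finset.sum_mul]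
      rw [Finset.sum_comm, Finset.sum_congr rfl fun d hd =>
        sum_ramanujanSum_mul_exp hN (hpos d hd) (hdvd d hd) he (hdvd e heD)]
      simp [heD]
    have hconst : ∑ k ∈ Finset.range N, w⁻¹ ^ (2 * k + 1) = 0 := by
      rw [sum_odd_pow_eq_ite hN hwN, if_neg (hprim.inv.ne_one he)]
    refine not_isIntegral_two_mul_eq_odd hN
      (z := ∑ k ∈ Finset.range N, (g k : ℂ) * w⁻¹ ^ (2 * k + 1)) ?_ ?_
    · exact IsIntegral.sum _ fun k _ => isIntegral_algebraMap.mul (hw_int.pow _)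
    · rw [← hfourier]
      simp_rw [hg, Int.cast_add, add_mul, Finset.sum_add_distrib, ← Finset.mul_sum, hconst,
        mul_zero, zero_add, Finset.mul_sum, Int.cast_mul, Int.cast_ofNat, mul_assoc]
  · rintro rfl q₁ q₂ h₁ h₂ - -
    have hone : ∀ q, 0 < q → c 1 q = 1 := by
      intro q hq
      exact_mod_cast (hc 1 (Finset.mem_singleton_self 1) q hq).trans (ramanujanSum_one_left q)
    simp [hone q₁ h₁, hone q₂ h₂]

end
end

section
/- Let n be a positive integer divisible by 4 and let Γ = IOCG_n(D,σ) be an integral oriented circulant graph with Hermitian eigenvalues μ_0,…,μ_{n−1}, and assume D₂ = {d ∈ D : ν₂(n/d) = 2} = {n/4}. Then for 0 ≤ j ≤ n−1: if j is odd, μ_j = 2·σ(n/4)·(−1)^{(j+1)/2}; and if j is even, μ_j is divisible by 4. -/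
open Complex Finset

noncomputable section

theorem sum_filter_range_two_mul {M : Type*} [AddCommMonoid M] {p : ℕ → Prop} [DecidablePred p]
    {c : ℕ} (hp : ∀ k, p (c + k) ↔ p k) (f : ℕ → M) :
    ∑ k ∈ (range (c + c)).filter p, f k = ∑ k ∈ (range c).filter p, (f k + f (c + k)) := by
  simp only [sum_filter, sum_range_add, hp, ← sum_add_distrib]
  refine sum_congr rfl fun k _ => ?_
  split_ifs <;> simp

theorem coprime_mul_add_iff (c k m : ℕ) : (c * m + k).Coprime m ↔ k.Coprime m := by
  simp

theorem sum_Gsetr {M : Type*} [AddCommMonoid M] {d m r : ℕ} (hd : 0 < d) (hr : r = 1 ∨ r = 3)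
    (f : ℕ → M) :
    ∑ a ∈ Gsetr (d * (8 * m)) r d, f a =
      ∑ k ∈ (range (8 * m)).filter (fun k => k % 4 = r ∧ k.Coprime m), f (d * k) := by
  have key : ∀ k, k % 4 = r → (Nat.gcd (d * k) (d * (8 * m)) = d ↔ k.Coprime m) := by
    intro k hk
    have h2 : Nat.Coprime k (2 ^ 3) :=
      Nat.Coprime.pow_right 3 (Nat.coprime_two_right.2 (Nat.odd_iff.2 (by omega)))
    rw [Nat.gcd_mul_left, Nat.mul_eq_left hd.ne', ← Nat.coprime_iff_gcd_eq_one,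
      Nat.coprime_mul_iff_right]
    exact and_iff_right h2
  symm
  refine sum_nbij' (fun k => d * k) (fun a => a / d) ?_ ?_ ?_ ?_ ?_
  · intro k hk
    simp only [mem_filter, mem_range, Gsetr] at hk ⊢
    rw [Nat.mul_div_cancel_left k hd, key k hk.2.1]
    exact ⟨Nat.mul_lt_mul_of_pos_left hk.1 hd, dvd_mul_right d k, hk.2⟩
  · intro a ha
    simp only [mem_filter, mem_range, Gsetr] at ha ⊢
    obtain ⟨hlt, ⟨k, rfl⟩, hk, hg⟩ := ha
    rw [Nat.mul_div_cancel_left k hd] at hk ⊢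
    exact ⟨lt_of_mul_lt_mul_left hlt (Nat.zero_le d), hk, (key k hk).1 hg⟩
  · intro k _
    exact Nat.mul_div_cancel_left k hd
  · intro a ha
    exact Nat.mul_div_cancel' (mem_filter.1 ha).2.1
  · intro k _
    rfl

/-- Modulo `8m`, negation exchanges the units congruent to `1` and to `3` modulo `4`. -/
theorem sum_inv_pow_filter {m : ℕ} {x : ℂ} (hx : x ^ (8 * m) = 1) {r : ℕ}
    (hr : r = 1 ∨ r = 3) :
    ∑ k ∈ (range (8 * m)).filter (fun k => k % 4 = r ∧ k.Coprime m), (x ^ k)⁻¹ =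
      ∑ k ∈ (range (8 * m)).filter (fun k => k % 4 = 4 - r ∧ k.Coprime m), x ^ k := by
  have cop : ∀ k ≤ 8 * m, (8 * m - k).Coprime m ↔ k.Coprime m := by
    intro k hk
    rw [← Nat.isCoprime_iff_coprime, ← Nat.isCoprime_iff_coprime, Nat.cast_sub hk]
    push_cast
    rw [sub_eq_neg_add, IsCoprime.add_mul_right_left_iff, IsCoprime.neg_left_iff]
  refine sum_nbij' (fun k => 8 * m - k) (fun k => 8 * m - k) ?_ ?_ ?_ ?_ ?_
  · intro k hk
    simp only [mem_filter, mem_range] at hk ⊢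
    rw [cop k hk.1.le]
    exact ⟨by omega, by omega, hk.2.2⟩
  · intro k hk
    simp only [mem_filter, mem_range] at hk ⊢
    rw [cop k hk.1.le]
    exact ⟨by omega, by omega, hk.2.2⟩
  · intro k hk
    simp only [mem_filter, mem_range] at hk
    omega
  · intro k hk
    simp only [mem_filter, mem_range] at hk
    omega
  · intro k hk
    simp only [mem_filter, mem_range] at hk
    refine inv_eq_of_mul_eq_one_right ?_
    rw [← pow_add, Nat.add_sub_cancel' hk.1.le, hx]

theorem sum_pow_sub_inv_eq_zero {m : ℕ} {x : ℂ} (hx : x ^ (4 * m) = -1) (r : ℕ) :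
    ∑ k ∈ (range (8 * m)).filter (fun k => k % 4 = r ∧ k.Coprime m), (x ^ k - (x ^ k)⁻¹) = 0 := by
  rw [show 8 * m = 4 * m + 4 * m by ring, sum_filter_range_two_mul]
  · refine sum_eq_zero fun k _ => ?_
    rw [pow_add, hx, neg_one_mul, inv_neg]
    ring
  · intro k
    rw [coprime_mul_add_iff, Nat.mul_add_mod]

theorem exists_isIntegral_sum_pow_odd {m : ℕ} {x : ℂ} (hi : IsIntegral ℤ x)
    (hx : x ^ (2 * m) = 1 ∨ x ^ (2 * m) = -1) :
    ∃ y : ℂ, IsIntegral ℤ y ∧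
      ∑ k ∈ (range (8 * m)).filter (fun k => k % 2 = 1 ∧ k.Coprime m), x ^ k = 4 * y := by
  have hc : ∀ c k, (2 * c * m + k) % 2 = 1 ∧ (2 * c * m + k).Coprime m ↔
      k % 2 = 1 ∧ k.Coprime m := by
    intro c k
    rw [coprime_mul_add_iff, mul_assoc, Nat.mul_add_mod]
  have h4 : x ^ (4 * m) = 1 := by
    rw [show 4 * m = 2 * m * 2 by ring, pow_mul]
    rcases hx with h | h <;> simp [h]
  have hs : ∑ k ∈ (range (8 * m)).filter (fun k => k % 2 = 1 ∧ k.Coprime m), x ^ k =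
      ∑ k ∈ (range (2 * m)).filter (fun k => k % 2 = 1 ∧ k.Coprime m),
        2 * (x ^ k + x ^ (2 * m) * x ^ k) := by
    rw [show 8 * m = 4 * m + 4 * m by ring, sum_filter_range_two_mul (hc 2),
      show 4 * m = 2 * m + 2 * m by ring, sum_filter_range_two_mul (hc 1)]
    refine sum_congr rfl fun k _ => ?_
    simp only [pow_add, ← two_mul (2 * m), ← mul_assoc, show 2 * 2 = 4 from rfl] at h4 ⊢
    linear_combination (x ^ k + x ^ (2 * m) * x ^ k) * h4
  rcases hx with h | h
  · refine ⟨∑ k ∈ (range (2 * m)).filter (fun k => k % 2 = 1 ∧ k.Coprime m), x ^ k,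
      IsIntegral.sum _ fun k _ => hi.pow k, ?_⟩
    rw [hs, mul_sum]
    refine sum_congr rfl fun k _ => ?_
    rw [h]
    ring
  · refine ⟨0, isIntegral_zero, ?_⟩
    rw [hs, mul_zero]
    refine sum_eq_zero fun k _ => ?_
    rw [h]
    ring

theorem exists_isIntegral_sum_pow_sub_inv {m : ℕ} {x : ℂ} (hi : IsIntegral ℤ x)
    (hx : x ^ (2 * m) = 1 ∨ x ^ (2 * m) = -1) {r : ℕ} (hr : r = 1 ∨ r = 3) :
    ∃ y : ℂ, IsIntegral ℤ y ∧
      ∑ k ∈ (range (8 * m)).filter (fun k => k % 4 = r ∧ k.Coprime m), (x ^ k - (x ^ k)⁻¹) =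
        4 * y := by
  have h4 : x ^ (4 * m) = 1 := by
    rw [show 4 * m = 2 * m * 2 by ring, pow_mul]
    rcases hx with h | h <;> simp [h]
  have h8 : x ^ (8 * m) = 1 := by
    rw [show 8 * m = 4 * m * 2 by ring, pow_mul, h4, one_pow]
  obtain ⟨y, hy, hsum⟩ := exists_isIntegral_sum_pow_odd hi hx
  have hsplit : ∑ k ∈ (range (8 * m)).filter (fun k => k % 2 = 1 ∧ k.Coprime m), x ^ k =
      ∑ k ∈ (range (8 * m)).filter (fun k => k % 4 = r ∧ k.Coprime m), x ^ k +
      ∑ k ∈ (range (8 * m)).filter (fun k => k % 4 = 4 - r ∧ k.Coprime m), x ^ k := by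
    rw [← sum_union]
    · congr 1
      ext k
      simp only [mem_filter, mem_union, mem_range]
      have : k % 2 = 1 ↔ k % 4 = r ∨ k % 4 = 4 - r := by omega
      tauto
    · refine disjoint_filter.2 fun k _ h1 h2 => ?_
      omega
  have hhalf : ∑ k ∈ (range (8 * m)).filter (fun k => k % 4 = r ∧ k.Coprime m), x ^ k =
      2 * ∑ k ∈ (range (4 * m)).filter (fun k => k % 4 = r ∧ k.Coprime m), x ^ k := by
    rw [show 8 * m = 4 * m + 4 * m by ring, sum_filter_range_two_mul, mul_sum]
    · refine sum_congr rfl fun k _ => ?_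
      rw [pow_add, h4]
      ring
    · intro k
      rw [coprime_mul_add_iff, Nat.mul_add_mod]
  refine ⟨∑ k ∈ (range (4 * m)).filter (fun k => k % 4 = r ∧ k.Coprime m), x ^ k - y,
    (IsIntegral.sum _ fun k _ => hi.pow k).sub hy, ?_⟩
  rw [sum_sub_distrib, sum_inv_pow_filter h8 hr]
  linear_combination 2 * hhalf - hsum + hsplit

theorem eigval_eq_sum_pow (n : ℕ) (C : Finset ℕ) (j : ℕ) :
    eigval n C j = I * ∑ k ∈ C, ((exp (2 * Real.pi * I / n) ^ j) ^ k -
      ((exp (2 * Real.pi * I / n) ^ j) ^ k)⁻¹) := by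
  unfold eigval
  congr 1
  refine sum_congr rfl fun k _ => ?_
  rw [← pow_mul, ← Complex.exp_nat_mul, ← Complex.exp_neg]
  push_cast
  congr 2 <;> ring_nf

theorem eigval_symbol (n : ℕ) (D : Finset ℕ) (σ : ℕ → ℤ) (j : ℕ) :
    eigval n (symbol n D σ) j =
      ∑ d ∈ D, eigval n (Gsetr n (if σ d = 1 then 1 else 3) d) j := by
  unfold eigval symbol
  rw [sum_biUnion, mul_sum]
  intro d _ e _ hde
  refine Finset.disjoint_left.2 fun a ha hb => hde ?_
  simp only [Gsetr, mem_filter] at ha hb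
  exact ha.2.2.2.symm.trans hb.2.2.2

theorem exp_pow_eq_I {m : ℕ} (hm : m ≠ 0) : exp (2 * Real.pi * I / (4 * m : ℕ)) ^ m = I := by
  have h : (m : ℂ) ≠ 0 := Nat.cast_ne_zero.2 hm
  rw [← Complex.exp_nat_mul]
  refine Eq.trans (congrArg exp ?_) Complex.exp_pi_div_two_mul_I
  push_cast
  field_simp
  norm_num

theorem isIntegral_exp_two_pi_div {n : ℕ} (hn : n ≠ 0) :
    IsIntegral ℤ (exp (2 * Real.pi * I / n)) :=
  (Complex.isPrimitiveRoot_exp n hn).isIntegral (Nat.pos_of_ne_zero hn)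

theorem eigval_Gsetr_eq {d m r : ℕ} (hd : 0 < d) (hr : r = 1 ∨ r = 3) (j : ℕ) :
    eigval (d * (8 * m)) (Gsetr (d * (8 * m)) r d) j =
      I * ∑ k ∈ (range (8 * m)).filter (fun k => k % 4 = r ∧ k.Coprime m),
        (((exp (2 * Real.pi * I / (d * (8 * m) : ℕ)) ^ (j * d)) ^ k) -
          ((exp (2 * Real.pi * I / (d * (8 * m) : ℕ)) ^ (j * d)) ^ k)⁻¹) := by
  rw [eigval_eq_sum_pow, sum_Gsetr hd hr]
  simp only [← pow_mul, mul_assoc]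

theorem exp_pow_pow_two_mul {d m : ℕ} (hd : 0 < d) (hm : 0 < m) (j : ℕ) :
    (exp (2 * Real.pi * I / (d * (8 * m) : ℕ)) ^ (j * d)) ^ (2 * m) = I ^ j := by
  rw [show d * (8 * m) = 4 * (2 * m * d) by ring, ← pow_mul,
    show j * d * (2 * m) = 2 * m * d * j by ring, pow_mul, exp_pow_eq_I (by positivity)]

theorem eigval_Gsetr_of_odd {n d r j : ℕ} (hn : 0 < n) (h : d * 8 ∣ n) (hr : r = 1 ∨ r = 3)
    (hj : Odd j) : eigval n (Gsetr n r d) j = 0 := by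
  obtain ⟨m, rfl⟩ := h
  have hd : 0 < d := Nat.pos_of_ne_zero fun h => by simp [h] at hn
  have hm : 0 < m := Nat.pos_of_ne_zero fun h => by simp [h] at hn
  rw [mul_assoc, eigval_Gsetr_eq hd hr, sum_pow_sub_inv_eq_zero, mul_zero]
  rw [show 4 * m = 2 * m * 2 by ring, pow_mul, exp_pow_pow_two_mul hd hm, ← pow_mul, mul_comm,
    pow_mul, I_sq, hj.neg_one_pow]

theorem exists_isIntegral_eigval_Gsetr_of_even {n d r j : ℕ} (hn : 0 < n) (h : d * 8 ∣ n)
    (hr : r = 1 ∨ r = 3) (hj : Even j) :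
    ∃ y : ℂ, IsIntegral ℤ y ∧ eigval n (Gsetr n r d) j = 4 * y := by
  have hint := isIntegral_exp_two_pi_div hn.ne'
  obtain ⟨m, rfl⟩ := h
  have hd : 0 < d := Nat.pos_of_ne_zero fun h => by simp [h] at hn
  have hm : 0 < m := Nat.pos_of_ne_zero fun h => by simp [h] at hn
  rw [mul_assoc d 8 m] at hint ⊢
  obtain ⟨y, hy, hsum⟩ := exists_isIntegral_sum_pow_sub_inv (hint.pow (j * d))
    (m := m) (r := r) (by
      obtain ⟨i, rfl⟩ := hj.exists_two_nsmul
      rw [exp_pow_pow_two_mul hd hm, smul_eq_mul, pow_mul, I_sq]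
      exact neg_one_pow_eq_or ℂ i) hr
  refine ⟨I * y, IsIntegral.mul ?_ hy, ?_⟩
  · exact Complex.isIntegral_int_I
  · rw [eigval_Gsetr_eq hd hr, hsum]
    ring

theorem Gsetr_four_mul {m r : ℕ} (hm : 0 < m) (hr : r = 1 ∨ r = 3) :
    Gsetr (4 * m) r m = {m * r} := by
  ext a
  simp only [Gsetr, mem_filter, mem_range, mem_singleton]
  constructor
  · rintro ⟨hlt, ⟨k, rfl⟩, hk, -⟩
    rw [Nat.mul_div_cancel_left k hm] at hk
    have : k < 4 := by
      rw [mul_comm 4] at hlt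
      exact lt_of_mul_lt_mul_left hlt (Nat.zero_le m)
    rw [← hk, Nat.mod_eq_of_lt this]
  · rintro rfl
    rw [Nat.mul_div_cancel_left r hm, mul_comm 4 m, Nat.gcd_mul_left]
    refine ⟨Nat.mul_lt_mul_of_pos_left (by omega) hm, dvd_mul_right m r, by omega, ?_⟩
    rcases hr with rfl | rfl <;> simp

theorem eigval_Gsetr_four_mul {m r : ℕ} (hm : 0 < m) (hr : r = 1 ∨ r = 3) (j : ℕ) :
    eigval (4 * m) (Gsetr (4 * m) r m) j = I * ((I ^ j) ^ r - ((I ^ j) ^ r)⁻¹) := by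
  rw [eigval_eq_sum_pow, Gsetr_four_mul hm hr, sum_singleton, ← pow_mul,
    show j * (m * r) = m * (j * r) by ring, pow_mul, exp_pow_eq_I hm.ne', ← pow_mul]

theorem four_dvd_of_isIntegral {a : ℤ} {y : ℂ} (hy : IsIntegral ℤ y) (h : (a : ℂ) = 4 * y) :
    (4 : ℤ) ∣ a := by
  have hq : algebraMap ℚ ℂ (a / 4) = y := by
    simp [h]
  rw [← hq, isIntegral_algebraMap_iff (algebraMap ℚ ℂ).injective,
    IsIntegrallyClosed.isIntegral_iff] at hy
  obtain ⟨b, hb⟩ := hy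
  refine ⟨b, ?_⟩
  have : (a : ℚ) = 4 * b := by
    rw [eq_intCast] at hb
    rw [hb]
    ring
  exact_mod_cast this

theorem mul_eight_dvd_of_padicValNat_ne_two {n d : ℕ} (hn : 0 < n) (hn4 : 4 ∣ n)
    (hd : d ∣ n / 4) (h : padicValNat 2 (n / d) ≠ 2) : d * 8 ∣ n := by
  obtain ⟨m, rfl⟩ := hn4
  rw [Nat.mul_div_cancel_left m (by norm_num)] at hd
  obtain ⟨k, rfl⟩ := hd
  have hd : 0 < d := Nat.pos_of_ne_zero fun h => by simp [h] at hn
  have hk : k ≠ 0 := fun h => by simp [h] at hn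
  rw [show 4 * (d * k) = d * (2 ^ 2 * k) by ring, Nat.mul_div_cancel_left _ hd,
    padicValNat.mul (by norm_num) hk, padicValNat.prime_pow] at h
  have h2 : 2 ∣ k := dvd_of_one_le_padicValNat (by omega)
  obtain ⟨l, rfl⟩ := h2
  exact ⟨l, by ring⟩

theorem eigval_of_D2_singleton (n : ℕ) [NeZero n] (hn4 : 4 ∣ n)
    (D : Finset ℕ) (hD : ∀ d ∈ D, d ∣ n / 4)
    (σ : ℕ → ℤ) (hσ : ∀ d ∈ D, σ d = 1 ∨ σ d = -1)
    (μ : ℕ → ℤ) (hμ : ∀ j < n, (μ j : ℂ) = eigval n (symbol n D σ) j)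
    (hD2 : D.filter (fun d => padicValNat 2 (n / d) = 2) = {n / 4}) :
    ∀ j < n, (Odd j → μ j = 2 * σ (n / 4) * (-1) ^ ((j + 1) / 2)) ∧
      (Even j → (4 : ℤ) ∣ μ j) := by
  intro j hj
  have hn : 0 < n := NeZero.pos n
  have hmem : n / 4 ∈ D := (mem_filter.1 (hD2 ▸ mem_singleton_self (n / 4))).1
  have h8 : ∀ d ∈ D.erase (n / 4), d * 8 ∣ n := by
    intro d hd
    obtain ⟨hne, hdD⟩ := mem_erase.1 hd
    refine mul_eight_dvd_of_padicValNat_ne_two hn hn4 (hD d hdD) fun h => hne ?_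
    exact mem_singleton.1 (hD2 ▸ mem_filter.2 ⟨hdD, h⟩)
  have hr : ∀ d, (if σ d = 1 then 1 else 3) = 1 ∨ (if σ d = 1 then 1 else 3) = 3 := by
    intro d
    split_ifs <;> simp
  have hsum := hμ j hj
  rw [eigval_symbol, ← add_sum_erase D _ hmem] at hsum
  have hmain : eigval n (Gsetr n (if σ (n / 4) = 1 then 1 else 3) (n / 4)) j =
      I * ((I ^ j) ^ (if σ (n / 4) = 1 then 1 else 3) -
        ((I ^ j) ^ (if σ (n / 4) = 1 then 1 else 3))⁻¹) := by
    obtain ⟨m, rfl⟩ := hn4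
    rw [Nat.mul_div_cancel_left m (by norm_num)]
    exact eigval_Gsetr_four_mul (by omega) (hr m) j
  rw [hmain] at hsum
  constructor
  · intro hodd
    rw [sum_eq_zero fun d hd => eigval_Gsetr_of_odd hn (h8 d hd) (hr d) hodd, add_zero] at hsum
    obtain ⟨i, rfl⟩ := hodd
    have hI : I ^ (2 * i + 1) = (-1) ^ i * I := by
      rw [pow_succ, pow_mul, I_sq]
    have hcast : (μ (2 * i + 1) : ℂ) =
        ((2 * σ (n / 4) * (-1) ^ ((2 * i + 1 + 1) / 2) : ℤ) : ℂ) := by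
      rw [hsum, hI, show (2 * i + 1 + 1) / 2 = i + 1 by omega]
      rcases neg_one_pow_eq_or ℂ i with h | h <;> rcases hσ _ hmem with hs | hs <;>
        simp [hs, h, pow_succ, inv_I] <;> ring_nf <;> simp [I_sq]
    exact_mod_cast hcast
  · intro heven
    have hz : I * ((I ^ j) ^ (if σ (n / 4) = 1 then 1 else 3) -
        ((I ^ j) ^ (if σ (n / 4) = 1 then 1 else 3))⁻¹) = 0 := by
      obtain ⟨i, rfl⟩ := heven.exists_two_nsmul
      rw [smul_eq_mul, pow_mul, I_sq]
      rcases neg_one_pow_eq_or ℂ i with h | h <;> split_ifs <;> norm_num [h]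
    rw [hz, zero_add] at hsum
    choose! y hy hval using fun d (hd : d ∈ D.erase (n / 4)) =>
      exists_isIntegral_eigval_Gsetr_of_even hn (h8 d hd) (hr d) heven
    rw [sum_congr rfl hval, ← mul_sum] at hsum
    exact four_dvd_of_isIntegral (IsIntegral.sum _ hy) hsum

end
end

section
/- Let n be a positive integer divisible by 4. The number of pairs (D,σ), where D is a set of positive divisors of n/4 and σ : D → {1,−1}, such that {d ∈ D : ν₂(n/d) = 2} = {n/4} (equivalently, such that the integral oriented circulant graph IOCG_n(D,σ) has perfect state transfer) equals 2 · 3^{τ(n/4) − τ(n/2^{ν₂(n)})}. Equivalently, the number of functions f from the set of positive divisors of n/4 to {1, 0, −1} such that {d : f(d) ≠ 0 and ν₂(n/d) = 2} = {n/4} equals 2 · 3^{τ(n/4) − τ(n/2^{ν₂(n)})}. -/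
open Complex Finset

noncomputable section

theorem prod_ite_eq_ite {ι M : Type*} [Fintype ι] [DecidableEq ι] [CommMonoid M] {P : ι → Prop}
    [DecidablePred P] {a : ι} (ha : P a) (x y : M) :
    ∏ i, (if i = a then x else if P i then 1 else y) = x * y ^ #{i | ¬ P i} := by
  have h : ∀ i, (if i = a then x else if P i then 1 else y) =
      (if i = a then x else 1) * (if P i then 1 else y) := by
    intro i
    by_cases hi : i = a
    · subst hi; simp [ha]
    · simp [hi]
  simp only [h, Finset.prod_mul_distrib, Finset.prod_ite_eq', Finset.prod_ite]
  simp

theorem padicValNat_four_mul_eq_two_iff {x : ℕ} (hx : x ≠ 0) :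
    padicValNat 2 (4 * x) = 2 ↔ ¬ 2 ∣ x := by
  have h4 : padicValNat 2 4 = 2 := padicValNat.prime_pow (p := 2) 2
  rw [padicValNat.mul (by norm_num) hx, h4, dvd_iff_padicValNat_ne_zero hx]
  omega

theorem four_mul_div_self_div {n d : ℕ} (hn : 4 ∣ n) (hd : d ∣ n / 4) :
    n / d = 4 * (n / 4 / d) := by
  rw [← Nat.mul_div_assoc _ hd, Nat.mul_div_cancel' hn]

theorem odd_dvd_div_four_iff {n x : ℕ} (hn0 : 0 < n) (hn4 : 4 ∣ n) :
    x ∣ n / 4 ∧ ¬ 2 ∣ x ↔ x ∣ n / 2 ^ padicValNat 2 n := by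
  have hn : n ≠ 0 := hn0.ne'
  have hv : 2 ≤ padicValNat 2 n := (padicValNat_dvd_iff_le hn).1 (by simpa using hn4)
  have hpow : 2 ^ padicValNat 2 n ∣ n := pow_padicValNat_dvd
  constructor
  · rintro ⟨h, hx⟩
    have hc : Nat.Coprime x (2 ^ padicValNat 2 n) :=
      (((Nat.Prime.coprime_iff_not_dvd Nat.prime_two).2 hx).symm).pow_right _
    refine hc.dvd_of_dvd_mul_left ?_
    rw [Nat.mul_div_cancel' hpow]
    exact h.trans (Nat.div_dvd_of_dvd hn4)
  · intro h
    constructor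
    · exact h.trans (Nat.div_dvd_div_left hpow (pow_dvd_pow 2 hv))
    · intro h2
      obtain ⟨k, hk⟩ := h2.trans h
      have : 2 ^ (padicValNat 2 n + 1) ∣ n := by
        refine ⟨k, ?_⟩
        rw [pow_succ, mul_assoc, ← hk, Nat.mul_div_cancel' hpow]
      exact pow_succ_padicValNat_not_dvd hn this

theorem card_divisors_padicValNat_div_eq_two {n : ℕ} (hn0 : 0 < n) (hn4 : 4 ∣ n) :
    #{d ∈ (n / 4).divisors | padicValNat 2 (n / d) = 2} =
      #(n / 2 ^ padicValNat 2 n).divisors := by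
  have hm : n / 4 ≠ 0 := by omega
  have hpos : n / 2 ^ padicValNat 2 n ≠ 0 :=
    (Nat.div_pos (Nat.le_of_dvd hn0 pow_padicValNat_dvd) (by positivity)).ne'
  have hdiv : ∀ d ∈ (n / 4).divisors, n / 4 / d ≠ 0 := fun d hd =>
    (Nat.div_pos (Nat.divisor_le hd) (Nat.pos_of_mem_divisors hd)).ne'
  refine Finset.card_bij' (fun d _ => n / 4 / d) (fun e _ => n / 4 / e) ?_ ?_ ?_ ?_
  · intro d hd
    obtain ⟨hd, hv⟩ := Finset.mem_filter.1 hd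
    have hdm := Nat.dvd_of_mem_divisors hd
    rw [four_mul_div_self_div hn4 hdm, padicValNat_four_mul_eq_two_iff (hdiv d hd)] at hv
    exact Nat.mem_divisors.2
      ⟨(odd_dvd_div_four_iff hn0 hn4).1 ⟨Nat.div_dvd_of_dvd hdm, hv⟩, hpos⟩
  · intro e he
    obtain ⟨hem, h2⟩ := (odd_dvd_div_four_iff hn0 hn4).2 (Nat.dvd_of_mem_divisors he)
    have hd : n / 4 / e ∈ (n / 4).divisors :=
      Nat.mem_divisors.2 ⟨Nat.div_dvd_of_dvd hem, hm⟩
    refine Finset.mem_filter.2 ⟨hd, ?_⟩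
    rw [four_mul_div_self_div hn4 (Nat.div_dvd_of_dvd hem),
      padicValNat_four_mul_eq_two_iff (hdiv _ hd), Nat.div_div_self hem hm]
    exact h2
  · intro d hd
    exact Nat.div_div_self (Nat.dvd_of_mem_divisors (Finset.mem_filter.1 hd).1) hm
  · intro e he
    exact Nat.div_div_self
      ((odd_dvd_div_four_iff hn0 hn4).2 (Nat.dvd_of_mem_divisors he)).1 hm

open scoped Classical in
theorem count_pst (n : ℕ) (hn0 : 0 < n) (hn4 : 4 ∣ n) :
    ((Finset.univ :
        Finset (↑((n / 4).divisors) → ↑({-1, 0, 1} : Finset ℤ))).filter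
      (fun f => (n / 4).divisors.filter (fun d => padicValNat 2 (n / d) = 2 ∧
          ∀ h : d ∈ (n / 4).divisors, (f ⟨d, h⟩ : ℤ) ≠ 0) = {n / 4})).card =
      2 * 3 ^ ((n / 4).divisors.card - (n / 2 ^ (padicValNat 2 n)).divisors.card) := by
  have hm : n / 4 ≠ 0 := by omega
  let P : ↥(n / 4).divisors → Prop := fun d => padicValNat 2 (n / d) = 2
  let a : ↥(n / 4).divisors := ⟨n / 4, Nat.mem_divisors_self _ hm⟩
  have ha : P a := by
    change padicValNat 2 (n / (n / 4)) = 2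
    rw [Nat.div_div_self hn4 hn0.ne']
    exact padicValNat.prime_pow (p := 2) 2
  have hset : (Finset.univ : Finset (↥(n / 4).divisors → ↥({-1, 0, 1} : Finset ℤ))).filter
      (fun f => (n / 4).divisors.filter (fun d => padicValNat 2 (n / d) = 2 ∧
          ∀ h : d ∈ (n / 4).divisors, (f ⟨d, h⟩ : ℤ) ≠ 0) = {n / 4}) =
      Fintype.piFinset fun d => if d = a then ({x | (x : ℤ) ≠ 0} : Finset ↥({-1, 0, 1} : Finset ℤ))
        else if P d then ({x | (x : ℤ) = 0} : Finset ↥({-1, 0, 1} : Finset ℤ)) else Finset.univ := by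
    ext f
    simp only [Finset.mem_filter, Finset.mem_univ, true_and, Fintype.mem_piFinset]
    constructor
    · intro h d
      have hd := Finset.ext_iff.1 h d
      simp only [Finset.mem_filter, d.2, true_and, Finset.mem_singleton, forall_true_left,
        Subtype.coe_eta] at hd
      by_cases hda : d = a
      · subst hda
        rw [if_pos rfl]
        exact Finset.mem_filter.2 ⟨Finset.mem_univ _, (hd.2 rfl).2⟩
      · have hne : (d : ℕ) ≠ n / 4 := fun e => hda (Subtype.ext e)
        by_cases hP : P d
        · simp only [hda, hP, if_true, if_false, Finset.mem_filter, Finset.mem_univ, true_and]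
          by_contra h0
          exact hne (hd.1 ⟨hP, h0⟩)
        · rw [if_neg hda, if_neg hP]
          exact Finset.mem_univ _
    · intro h
      ext d
      simp only [Finset.mem_filter, Finset.mem_singleton]
      constructor
      · rintro ⟨hd, hP, h0⟩
        by_contra hne
        have hda : (⟨d, hd⟩ : ↥(n / 4).divisors) ≠ a := fun e => hne (congrArg Subtype.val e)
        have hP' : P ⟨d, hd⟩ := hP
        have := h ⟨d, hd⟩
        simp only [hda, hP', if_true, if_false, Finset.mem_filter, Finset.mem_univ,
          true_and] at this
        exact h0 hd this
      · rintro rfl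
        refine ⟨a.2, ha, fun _ => ?_⟩
        have h' := h a
        rw [if_pos rfl] at h'
        exact (Finset.mem_filter.1 h').2
  have hcard : #(Finset.univ.filter fun d => ¬ P d) =
      #(n / 4).divisors - #(n / 2 ^ padicValNat 2 n).divisors := by
    rw [← card_divisors_padicValNat_div_eq_two hn0 hn4]
    have h1 : #(Finset.univ.filter P) =
        #{d ∈ (n / 4).divisors | padicValNat 2 (n / d) = 2} := by
      rw [← Finset.card_map (Function.Embedding.subtype _)]
      congr 1
      ext d
      simp [P, and_comm]
    have h2 := Finset.card_filter_add_card_filter_not (s := Finset.univ) P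
    rw [Finset.card_univ, Fintype.card_coe] at h2
    omega
  rw [hset, Fintype.card_piFinset, ← hcard, ← prod_ite_eq_ite ha]
  refine Finset.prod_congr rfl fun d _ => ?_
  have hne : #({x | (x : ℤ) ≠ 0} : Finset ↥({-1, 0, 1} : Finset ℤ)) = 2 := by
    convert (by decide : #({x | (x : ℤ) ≠ 0} : Finset ↥({-1, 0, 1} : Finset ℤ)) = 2)
  have heq : #({x | (x : ℤ) = 0} : Finset ↥({-1, 0, 1} : Finset ℤ)) = 1 := by
    convert (by decide : #({x | (x : ℤ) = 0} : Finset ↥({-1, 0, 1} : Finset ℤ)) = 1)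
  split_ifs
  · exact hne
  · exact heq
  · rfl

end
end

section
/- Let n be a positive integer divisible by 4, let Γ = IOCG_n(D,σ) be an integral oriented circulant graph, and let a, b ∈ Z_n be distinct vertices. If Γ has perfect state transfer between a and b, then a − b ∈ {n/4, n/2, 3n/4} in Z_n. -/
open Complex Finset

noncomputable section

lemma exp_submatrix_equiv {m l : Type*} [Fintype m] [DecidableEq m] [Fintype l] [DecidableEq l]
    (g : l ≃ m) (A : Matrix m m ℂ) :
    NormedSpace.exp (A.submatrix g g) = (NormedSpace.exp A).submatrix g g := by
  let f := Matrix.reindexAlgEquiv ℚ ℂ g.symm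
  have hf : Continuous f := Continuous.matrix_reindex continuous_id g.symm g.symm
  have hf' : Continuous f.symm := Continuous.matrix_reindex continuous_id g g
  change NormedSpace.exp (f A) = f (NormedSpace.exp A)
  simp_rw [NormedSpace.exp_eq_tsum_rat]
  rw [Function.LeftInverse.map_tsum _ hf hf' f.symm_apply_apply]
  simp_rw [map_smul, map_pow]

lemma ZMod.mul_natCast_val_mem_symbol_iff {n : ℕ} [NeZero n] (hn4 : 4 ∣ n) {D : Finset ℕ}
    (hD : ∀ d ∈ D, d ∣ n / 4) (σ : ℕ → ℤ) {k : ℕ} (hk : k ≡ 1 [MOD 4]) (hkn : k.Coprime n)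
    (x : ZMod n) : ((k : ZMod n) * x).val ∈ symbol n D σ ↔ x.val ∈ symbol n D σ := by
  have hval : ((k : ZMod n) * x).val ≡ k * x.val [MOD n] := by
    rw [← ZMod.natCast_eq_natCast_iff]
    simp
  have hgcd : Nat.gcd ((k : ZMod n) * x).val n = Nat.gcd x.val n := by
    rw [hval.gcd_eq, Nat.Coprime.gcd_mul_left_cancel _ hkn]
  simp only [symbol, Gsetr, Finset.mem_biUnion, Finset.mem_filter, Finset.mem_range,
    ZMod.val_lt, true_and, hgcd]
  refine exists_congr fun d => and_congr_right fun hd => ?_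
  have key (h : Nat.gcd x.val n = d) :
      (d ∣ ((k : ZMod n) * x).val ↔ d ∣ x.val) ∧
        ((k : ZMod n) * x).val / d % 4 = x.val / d % 4 := by
    have hdx : d ∣ x.val := h ▸ Nat.gcd_dvd_left _ _
    have hdy : d ∣ ((k : ZMod n) * x).val := by
      rw [← h, ← hgcd]; exact Nat.gcd_dvd_left _ _
    have hd0 : 0 < d := h ▸ Nat.gcd_pos_of_pos_right _ (NeZero.pos n)
    have hdn : d * 4 ∣ n := by
      obtain ⟨c, hc⟩ := hD d hd
      exact ⟨c, by rw [mul_right_comm, ← hc, Nat.div_mul_cancel hn4]⟩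
    refine ⟨by simp [hdx, hdy], ?_⟩
    obtain ⟨p, hp⟩ := hdx
    obtain ⟨q, hq⟩ := hdy
    have h1 : d * q ≡ d * p [MOD d * 4] := by
      have h2 := hval.of_dvd hdn
      rw [hp, hq] at h2
      have h3 : d * (k * p) ≡ d * (1 * p) [MOD d * 4] := (hk.mul_right p).mul_left' d
      rw [one_mul] at h3
      exact h2.trans (by rwa [mul_left_comm])
    rw [hp, hq, Nat.mul_div_cancel_left _ hd0, Nat.mul_div_cancel_left _ hd0]
    exact Nat.ModEq.mul_left_cancel' hd0.ne' h1
  constructor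
  · rintro ⟨h1, h2, h3⟩
    exact ⟨(key h3).1.1 h1, (key h3).2 ▸ h2, h3⟩
  · rintro ⟨h1, h2, h3⟩
    exact ⟨(key h3).1.2 h1, (key h3).2.symm ▸ h2, h3⟩

lemma hermMatrix_submatrix {n : ℕ} [NeZero n] {C : Finset ℕ} {k : ZMod n}
    (hC : ∀ x : ZMod n, (k * x).val ∈ C ↔ x.val ∈ C) {g : ZMod n → ZMod n}
    (hg : ∀ x y, g x - g y = k * (x - y)) :
    (hermMatrix n C).submatrix g g = hermMatrix n C := by
  ext u v
  simp [hermMatrix, hg, hC]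

lemma hasPST.mul_sub_eq {n : ℕ} [NeZero n] {C : Finset ℕ} {k : (ZMod n)ˣ}
    (hC : ∀ x : ZMod n, (k * x).val ∈ C ↔ x.val ∈ C) {a b : ZMod n} (h : hasPST n C a b) :
    k * (a - b) = a - b := by
  obtain ⟨t, γ, hγ, h⟩ := h
  have hγ0 : γ ≠ 0 := by rintro rfl; simp at hγ
  let g : ZMod n ≃ ZMod n := (Equiv.subRight a).trans (k.mulLeft.trans (Equiv.addRight a))
  have hg (x : ZMod n) : g x = k * (x - a) + a := rfl
  have hU : (transitionMatrix n C t).submatrix g g = transitionMatrix n C t := by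
    rw [transitionMatrix, ← exp_submatrix_equiv, Matrix.submatrix_smul, Pi.smul_apply,
      Pi.smul_apply, hermMatrix_submatrix hC fun x y => by rw [hg, hg]; ring]
  have hcol (x : ZMod n) : transitionMatrix n C t x a = if x = b then γ else 0 := by
    have := congrFun h x
    simpa [Pi.single_apply] using this
  have h1 : transitionMatrix n C t (g b) a = γ := by
    have h2 := congrFun (congrFun hU b) a
    rw [Matrix.submatrix_apply, hcol b, if_pos rfl] at h2
    simpa [hg] using h2
  rw [hcol] at h1
  have h3 : g b = b := by
    by_contra hne
    rw [if_neg hne] at h1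
    exact hγ0 h1.symm
  rw [hg] at h3
  linear_combination -h3

lemma exists_coprime_modEq_one_forall_dvd {n : ℕ} (hn : n ≠ 0) (hn4 : 4 ∣ n) :
    ∃ k : ℕ, k ≡ 1 [MOD 4] ∧ k.Coprime n ∧ ∀ s : ℤ, (n : ℤ) ∣ (k - 1) * s → (n : ℤ) ∣ 4 * s := by
  obtain ⟨e, m, hm, rfl⟩ := Nat.exists_eq_two_pow_mul_odd hn
  have hcop : (2 ^ e).Coprime m := (Nat.coprime_two_left.2 hm).pow_left e
  have h4 : 4 ∣ 2 ^ e :=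
    (Nat.Coprime.pow_left 2 (Nat.coprime_two_left.2 hm) : (2 ^ 2).Coprime m).dvd_of_dvd_mul_right hn4
  obtain ⟨k, hk2, hkm⟩ := Nat.chineseRemainder hcop 5 (m - 1)
  have hk4 : k ≡ 1 [MOD 4] := (hk2.of_dvd h4).trans rfl
  have hkm' : (m : ℤ) ∣ k + 1 := by
    have h := (hkm.add_right 1)
    rw [Nat.sub_add_cancel hm.pos] at h
    exact_mod_cast (Nat.modEq_zero_iff_dvd.1 (h.trans (Nat.modEq_zero_iff_dvd.2 dvd_rfl)))
  have hk2' : ((2 ^ e : ℕ) : ℤ) ∣ k - 5 := by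
    simpa using (Nat.modEq_iff_dvd.1 hk2.symm)
  refine ⟨k, hk4, ?_, fun s hs => ?_⟩
  · refine Nat.Coprime.mul_right (Nat.Coprime.pow_right e (Nat.coprime_two_right.2 ?_)) ?_
    · rw [Nat.odd_iff]
      have : k % 4 = 1 := hk4
      omega
    · refine Nat.isCoprime_iff_coprime.1 ?_
      obtain ⟨c, hc⟩ := hkm'
      exact ⟨-1, c, by linear_combination -hc⟩
  · push_cast at hs hk2' ⊢
    refine IsCoprime.mul_dvd (by exact_mod_cast Nat.isCoprime_iff_coprime.2 hcop) ?_ ?_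
    · have h := (dvd_of_mul_right_dvd hs).sub (hk2'.mul_right s)
      convert h using 1; ring
    · have h := ((hkm'.mul_right s).sub (dvd_of_mul_left_dvd hs)).mul_left 2
      convert h using 1; ring

lemma ZMod.eq_of_four_mul_eq_zero {n : ℕ} [NeZero n] (hn4 : 4 ∣ n) {s : ZMod n} (hs : s ≠ 0)
    (h : 4 * s = 0) : s = ((n / 4 : ℕ) : ZMod n) ∨ s = ((n / 2 : ℕ) : ZMod n) ∨
      s = ((3 * n / 4 : ℕ) : ZMod n) := by
  have hdvd : n ∣ 4 * s.val := by
    rw [← ZMod.natCast_eq_zero_iff]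
    simpa using h
  have hlt := s.val_lt
  have hpos : s.val ≠ 0 := by simpa using hs
  suffices s.val = n / 4 ∨ s.val = n / 2 ∨ s.val = 3 * n / 4 by
    rcases this with h | h | h <;> rw [← h] <;> simp
  obtain ⟨q, hq⟩ := hdvd
  have hq4 : q < 4 := by
    by_contra! hge
    have := Nat.mul_le_mul_left n hge
    omega
  interval_cases q <;> omega

theorem pst_difference (n : ℕ) [NeZero n] (hn4 : 4 ∣ n)
    (D : Finset ℕ) (hD : ∀ d ∈ D, d ∣ n / 4)
    (σ : ℕ → ℤ) (hσ : ∀ d ∈ D, σ d = 1 ∨ σ d = -1)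
    (a b : ZMod n) (hab : a ≠ b) (hpst : hasPST n (symbol n D σ) a b) :
    a - b = ((n / 4 : ℕ) : ZMod n) ∨ a - b = ((n / 2 : ℕ) : ZMod n) ∨
      a - b = ((3 * n / 4 : ℕ) : ZMod n) := by
  obtain ⟨k, hk4, hkn, hk⟩ := exists_coprime_modEq_one_forall_dvd (NeZero.ne n) hn4
  have hfix : (k : ZMod n) * (a - b) = a - b :=
    hpst.mul_sub_eq (k := ZMod.unitOfCoprime k hkn)
      (ZMod.mul_natCast_val_mem_symbol_iff hn4 hD σ hk4 hkn)
  refine ZMod.eq_of_four_mul_eq_zero hn4 (sub_ne_zero.2 hab) ?_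
  have h := hk (a - b).val <| by
    rw [← ZMod.intCast_zmod_eq_zero_iff_dvd]
    simpa [sub_mul, sub_eq_zero] using hfix
  rw [← ZMod.intCast_zmod_eq_zero_iff_dvd] at h
  simpa using h

end
end

section
/- Let n be a positive integer divisible by 4 and let Γ = IOCG_n(D,σ) be an integral oriented circulant graph. Then the following are equivalent: (i) for every b ∈ Z_n, Γ has perfect state transfer between b + n/4 and b, and between b + n/2 and b; (ii) for every b ∈ Z_n, Γ has multiple state transfer on the vertex set {b, b + n/4, b + n/2, b + 3n/4}. -/
open Complex Finset

noncomputable section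

/-- Perfect state transfer is symmetric: run the walk backwards in time. -/
theorem hasPST.symm {n : ℕ} [NeZero n] {C : Finset ℕ} {u v : ZMod n} (h : hasPST n C u v) :
    hasPST n C v u := by
  obtain ⟨t, γ, hγ, h⟩ := h
  have hγ0 : γ ≠ 0 := by
    rintro rfl
    simp at hγ
  have hinv : transitionMatrix n C (-t) * transitionMatrix n C t = 1 := by
    unfold transitionMatrix
    rw [← Matrix.exp_add_of_commute]
    · simp
    · exact ((Commute.refl _).smul_left _).smul_right _
  refine ⟨-t, γ⁻¹, by simp [hγ], ?_⟩
  have h' := congrArg (transitionMatrix n C (-t)).mulVec h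
  rw [Matrix.mulVec_mulVec, hinv, Matrix.one_mulVec, Matrix.mulVec_smul] at h'
  rw [h', smul_smul, inv_mul_cancel₀ hγ0, one_smul]

theorem pst_pair_iff_mst (n : ℕ) [NeZero n] (hn4 : 4 ∣ n)
    (D : Finset ℕ) (hD : ∀ d ∈ D, d ∣ n / 4)
    (σ : ℕ → ℤ) (hσ : ∀ d ∈ D, σ d = 1 ∨ σ d = -1) :
    (∀ b : ZMod n, hasPST n (symbol n D σ) (b + (n / 4 : ℕ)) b ∧
        hasPST n (symbol n D σ) (b + (n / 2 : ℕ)) b) ↔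
      (∀ b : ZMod n, hasMST n (symbol n D σ)
        {b, b + (n / 4 : ℕ), b + (n / 2 : ℕ), b + (3 * n / 4 : ℕ)}) := by
  obtain ⟨k, rfl⟩ := hn4
  have hk : 0 < k := by
    have := NeZero.ne (4 * k)
    omega
  have h1 : 4 * k / 4 = k := by omega
  have h2 : 4 * k / 2 = 2 * k := by omega
  have h3 : 3 * (4 * k) / 4 = 3 * k := by omega
  have hzero : (4 : ZMod (4 * k)) * (k : ZMod (4 * k)) = 0 := by
    exact_mod_cast ZMod.natCast_self (4 * k)
  simp only [h1, h2, h3]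
  set C := symbol (4 * k) D σ
  constructor
  · intro h
    have quarter : ∀ u v : ZMod (4 * k), u = v + k → hasPST (4 * k) C u v := by
      rintro u v rfl
      exact (h v).1
    have half : ∀ u v : ZMod (4 * k), u = v + 2 * k → hasPST (4 * k) C u v := by
      rintro u v rfl
      simpa using (h v).2
    intro b u hu v hv huv
    simp only [Set.mem_insert_iff, Set.mem_singleton_iff, Nat.cast_mul, Nat.cast_ofNat] at hu hv
    rcases hu with rfl | rfl | rfl | rfl <;> rcases hv with rfl | rfl | rfl | rfl <;>
      first
      | exact absurd rfl huv
      | exact quarter _ _ (by grind)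
      | exact half _ _ (by grind)
      | exact (quarter _ _ (by grind)).symm
  · intro h b
    have ne : ∀ m : ℕ, 0 < m → m < 4 * k → b + (m : ZMod (4 * k)) ≠ b := by
      intro m hm hlt heq
      have hdvd := (ZMod.natCast_eq_zero_iff m (4 * k)).1 (by simpa using heq)
      exact absurd (Nat.le_of_dvd hm hdvd) (by omega)
    exact ⟨h b _ (by simp) _ (by simp) (ne _ hk (by omega)),
      h b _ (by simp) _ (by simp) (ne _ (by omega) (by omega))⟩

end
end
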